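/- Consider the under-constrained counting chain with parameter q ∈ (0, 1/3). Then P( M₀^{(r)} = 0 for all r ∈ {1,…,R} | M₁^{(r)} ≤ n^q·log n for all r ∈ {−1, 0, 1, …, R} ) → 1 as n → ∞. -/

import Mathlib

open Filter Topology MeasureTheory ENNReal

noncomputable section

/-- `p₀(a,b) = b(b−1)/(4a(a−1))`. -/
def prob0 (a b : ℕ) : ℝ := ((b : ℝ) * ((b : ℝ) - 1)) / (4 * (a : ℝ) * ((a : ℝ) - 1))

/-- `p₁(a,b) = (a−b)b/(a(a−1))`. -/
def prob1 (a b : ℕ) : ℝ := (((a : ℝ) - (b : ℝ)) * (b : ℝ)) / ((a : ℝ) * ((a : ℝ) - 1))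

/-- `p₂(a,b) = (a−b)(a−b−1)/(a(a−1))`. -/
def prob2 (a b : ℕ) : ℝ :=
  (((a : ℝ) - (b : ℝ)) * ((a : ℝ) - (b : ℝ) - 1)) / ((a : ℝ) * ((a : ℝ) - 1))

/-- `p⋆(a,b) = 1 − p₀ − p₁ − p₂`. -/
def probStar (a b : ℕ) : ℝ := 1 - prob0 a b - prob1 a b - prob2 a b

/-- The probability vector `p(a,b) = (p₀,p₁,p₂,p⋆)(a,b)`. -/
def pvec (a b : ℕ) : Fin 4 → ℝ := ![prob0 a b, prob1 a b, prob2 a b, probStar a b]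

/-- The multinomial pmf with `N` trials, four categories. -/
def multinomialPMF (N : ℕ) (p : Fin 4 → ℝ) (k : Fin 4 → ℕ) : ℝ :=
  if (∑ i, k i) = N then
    (N.factorial : ℝ) / (∏ i, ((k i).factorial : ℝ)) * ∏ i, (p i) ^ (k i)
  else 0

/-- `R = ⌊n^{1−2q}/log³ n⌋`. -/
def RparU (n : ℕ) (q : ℝ) : ℕ := ⌊(n : ℝ) ^ (1 - 2 * q) / (Real.log n) ^ 3⌋₊

/-- `US a b h k = S^{(k−1)}`, where `S^{(−1)} = M₁^{(−1)} = a`, `S^{(0)} = a + b`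
(`M₁^{(0)} = b`) and `S^{(r)} = S^{(r−1)} + M₁^{(r)}` with `M₁^{(r)} = h r` for `r ≥ 1`. -/
def US (a b : ℕ) (h : ℕ → ℕ) : ℕ → ℕ
  | 0 => a
  | k + 1 => US a b h k + (if k = 0 then b else h k)

/-- `M₁^{(r−1)}` seen from round `r ≥ 1`. -/
def UM1prev (b : ℕ) (h : ℕ → ℕ) (r : ℕ) : ℕ := if r ≤ 1 then b else h (r - 1)

/-- The under-constrained counting chain: `A = M₁^{(−1)}`, `B = M₁^{(0)}`, and for rounds
`r ∈ {1,…,R}`, conditionally on all variables of rounds `< r`, the vector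
`M ω r = (M₀,M₁,M₂,M⋆)^{(r)}` is Multinomial with `n − S^{(r−1)}` trials and probability
vector `p(n − S^{(r−2)}, M₁^{(r−1)})`. -/
def IsUnderChain (n : ℕ) (q : ℝ) {Ω : Type*} [MeasurableSpace Ω] (P : Measure Ω)
    (A B : Ω → ℕ) (M : Ω → ℕ → Fin 4 → ℕ) : Prop :=
  Measurable A ∧ Measurable B ∧ (∀ r, Measurable (fun ω => M ω r)) ∧
  (∀ ω, A ω ≤ n) ∧ (∀ ω, B ω ≤ n) ∧
  ∀ r : ℕ, 1 ≤ r → r ≤ RparU n q → ∀ a b : ℕ, ∀ h : ℕ → Fin 4 → ℕ, ∀ v : Fin 4 → ℕ,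
    P {ω | A ω = a ∧ B ω = b ∧ (∀ s, 1 ≤ s → s < r → M ω s = h s) ∧ M ω r = v}
      = ENNReal.ofReal
          (multinomialPMF (n - US a b (fun s => h s 1) r)
            (pvec (n - US a b (fun s => h s 1) (r - 1))
              (UM1prev b (fun s => h s 1) r)) v)
        * P {ω | A ω = a ∧ B ω = b ∧ (∀ s, 1 ≤ s → s < r → M ω s = h s)}

/-- On functions of total `N`, `multinomialPMF` is the multinomial coefficient times the weights. -/
lemma multinomialPMF_of_sum_eq {N : ℕ} {p : Fin 4 → ℝ} {k : Fin 4 → ℕ} (hk : ∑ i, k i = N) :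
    multinomialPMF N p k = Nat.multinomial Finset.univ k * ∏ i, p i ^ k i := by
  have hne : (∏ i, ((k i).factorial : ℝ)) ≠ 0 :=
    Finset.prod_ne_zero_iff.2 fun i _ => by positivity
  have hspec : (∏ i, ((k i).factorial : ℝ)) * Nat.multinomial Finset.univ k = N.factorial := by
    rw [← hk]
    exact_mod_cast Nat.multinomial_spec Finset.univ k
  rw [multinomialPMF, if_pos hk, ← hspec, mul_div_cancel_left₀ _ hne]

lemma multinomialPMF_nonneg {N : ℕ} {p : Fin 4 → ℝ} (hp : ∀ i, 0 ≤ p i) (k : Fin 4 → ℕ) :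
    0 ≤ multinomialPMF N p k := by
  unfold multinomialPMF
  split_ifs
  · have := Finset.prod_nonneg fun i (_ : i ∈ Finset.univ) => pow_nonneg (hp i) (k i)
    positivity
  · exact le_rfl

lemma tsum_ofReal_multinomialPMF {N : ℕ} {p : Fin 4 → ℝ} (hp : ∀ i, 0 ≤ p i)
    (hsum : ∑ i, p i = 1) : ∑' k, ENNReal.ofReal (multinomialPMF N p k) = 1 := by
  rw [tsum_eq_sum (s := Finset.piAntidiag Finset.univ N),
    ← ENNReal.ofReal_sum_of_nonneg fun k _ => multinomialPMF_nonneg hp k]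
  · have h := Finset.sum_pow_eq_sum_piAntidiag Finset.univ p N
    rw [hsum, one_pow] at h
    rw [Finset.sum_congr rfl fun k hk =>
      multinomialPMF_of_sum_eq (Finset.mem_piAntidiag.1 hk).1, ← h, ENNReal.ofReal_one]
  · intro k hk
    rw [multinomialPMF, if_neg, ENNReal.ofReal_zero]
    simpa using hk

lemma succ_mul_multinomialPMF_add_single {N : ℕ} (p : Fin 4 → ℝ) (k : Fin 4 → ℕ) (i : Fin 4) :
    ((k i + 1 : ℕ) : ℝ) * multinomialPMF (N + 1) p (k + Pi.single i 1) =
      ((N + 1 : ℕ) : ℝ) * p i * multinomialPMF N p k := by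
  have hsum : ∑ j, (k + Pi.single i 1 : Fin 4 → ℕ) j = ∑ j, k j + 1 := by
    simp [Finset.sum_add_distrib]
  have hfac : ∏ j, (((k + Pi.single i 1 : Fin 4 → ℕ) j).factorial : ℝ) =
      (k i + 1) * ∏ j, ((k j).factorial : ℝ) := by
    fin_cases i <;> simp [Fin.prod_univ_four, Nat.factorial_succ] <;> ring
  have hpow : ∏ j, p j ^ (k + Pi.single i 1 : Fin 4 → ℕ) j = p i * ∏ j, p j ^ k j := by
    fin_cases i <;> simp [Fin.prod_univ_four, pow_succ] <;> ring
  unfold multinomialPMF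
  rw [hsum, hfac, hpow]
  by_cases h : ∑ j, k j = N
  · have hne : (∏ j, ((k j).factorial : ℝ)) ≠ 0 :=
      Finset.prod_ne_zero_iff.2 fun i _ => by positivity
    have hki : (k i + 1 : ℝ) ≠ 0 := by positivity
    rw [if_pos (by omega), if_pos h, Nat.factorial_succ]
    push_cast
    field_simp
  · rw [if_neg (by omega), if_neg h]
    simp

/-- The mean of the `i`-th coordinate of a multinomial vector. -/
lemma tsum_mul_ofReal_multinomialPMF {N : ℕ} {p : Fin 4 → ℝ} (hp : ∀ i, 0 ≤ p i)
    (hsum : ∑ i, p i = 1) (i : Fin 4) :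
    ∑' k : Fin 4 → ℕ, (k i : ℝ≥0∞) * ENNReal.ofReal (multinomialPMF N p k) =
      ENNReal.ofReal (N * p i) := by
  have hinj : Function.Injective fun k : Fin 4 → ℕ => k + Pi.single i 1 :=
    add_left_injective _
  rw [← hinj.tsum_eq]
  · cases N with
    | zero =>
      have h : ∀ k : Fin 4 → ℕ, multinomialPMF 0 p (k + Pi.single i 1) = 0 := fun k => by
        rw [multinomialPMF, if_neg]
        simp [Finset.sum_add_distrib]
      simp [h]
    | succ N =>
      rw [← mul_one (ENNReal.ofReal _), ← tsum_ofReal_multinomialPMF (N := N) hp hsum,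
        ← ENNReal.tsum_mul_left]
      refine tsum_congr fun k => ?_
      have hi : (k + Pi.single i 1 : Fin 4 → ℕ) i = k i + 1 := by simp
      rw [hi, ← ENNReal.ofReal_natCast, ← ENNReal.ofReal_mul (by positivity),
        succ_mul_multinomialPMF_add_single,
        ENNReal.ofReal_mul (mul_nonneg (by positivity) (hp i))]
  · intro k hk
    have hki : k i ≠ 0 := by
      rintro h
      simp [h] at hk
    refine ⟨k - Pi.single i 1, funext fun j => ?_⟩
    by_cases hj : j = i
    · subst hj
      simp
      omega
    · simp [hj]

lemma sum_pvec (a b : ℕ) : ∑ i, pvec a b i = 1 := by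
  simp [Fin.sum_univ_four, pvec, probStar]

lemma pvec_nonneg {a b : ℕ} (ha : 2 ≤ a) (hb : b ≤ a) (i : Fin 4) : 0 ≤ pvec a b i := by
  have ha' : (2 : ℝ) ≤ a := by exact_mod_cast ha
  have hb' : (b : ℝ) ≤ a := by exact_mod_cast hb
  have ha1 : (0 : ℝ) < a - 1 := by linarith
  have hself : ∀ m : ℕ, (0 : ℝ) ≤ m * ((m : ℝ) - 1) := fun m => by
    rcases Nat.eq_zero_or_pos m with rfl | hm
    · simp
    · have : (1 : ℝ) ≤ m := by exact_mod_cast hm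
      exact mul_nonneg (by positivity) (by linarith)
  have h0 : 0 ≤ prob0 a b := div_nonneg (hself b) (by positivity)
  have h1 : 0 ≤ prob1 a b := div_nonneg (mul_nonneg (by linarith) (by positivity)) (by positivity)
  have h2 : 0 ≤ prob2 a b := by
    have := hself (a - b)
    rw [Nat.cast_sub hb] at this
    exact div_nonneg this (by positivity)
  have h3 : 0 ≤ probStar a b := by
    have : probStar a b = (b * ((a - 1) - (b - 1) / 4)) / (a * (a - 1)) := by
      unfold probStar prob0 prob1 prob2
      field_simp
      ring
    rw [this]
    exact div_nonneg (mul_nonneg (by positivity) (by linarith)) (by positivity)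
  fin_cases i <;> simpa [pvec]

lemma sub_mul_prob1_le {a b : ℕ} (ha : 2 ≤ a) (hb : b ≤ a) :
    ((a : ℝ) - b) * prob1 a b ≤ b := by
  have ha' : (2 : ℝ) ≤ a := by exact_mod_cast ha
  have hb' : (b : ℝ) ≤ a := by exact_mod_cast hb
  have ha1 : (0 : ℝ) < a - 1 := by linarith
  rcases Nat.eq_zero_or_pos b with rfl | hpos
  · simp [prob1]
  have hb1 : (1 : ℝ) ≤ b := by exact_mod_cast hpos
  unfold prob1
  rw [mul_div_assoc', div_le_iff₀ (by positivity)]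
  have : ((a : ℝ) - b) * (a - b) ≤ a * (a - 1) :=
    mul_le_mul (by linarith) (by linarith) (by linarith) (by linarith)
  nlinarith

lemma sub_mul_prob0_le {n a b : ℕ} {L : ℝ} (hn : 4 ≤ n) (ha : (n : ℝ) / 2 ≤ a)
    (hb : b ≤ a) (hL : (b : ℝ) ≤ L) : ((a : ℝ) - b) * prob0 a b ≤ 2 * L ^ 2 / n := by
  have hn' : (4 : ℝ) ≤ n := by exact_mod_cast hn
  have hb' : (b : ℝ) ≤ a := by exact_mod_cast hb
  have hb0 : (0 : ℝ) ≤ b := by positivity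
  have ha0 : (0 : ℝ) < a := by linarith
  have ha1 : (a : ℝ) / 2 ≤ a - 1 := by linarith
  have hbL : (b : ℝ) ^ 2 ≤ L ^ 2 := by gcongr
  have h0 : prob0 a b ≤ L ^ 2 / (2 * a * a) := by
    unfold prob0
    apply div_le_div₀ (by positivity) (by nlinarith) (by positivity)
    nlinarith
  calc ((a : ℝ) - b) * prob0 a b ≤ ((a : ℝ) - b) * (L ^ 2 / (2 * a * a)) := by
        gcongr
    _ ≤ a * (L ^ 2 / (2 * a * a)) := by
        gcongr
        linarith
    _ = L ^ 2 / (2 * a) := by field_simp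
    _ ≤ L ^ 2 / (n / 2) := by
        gcongr
        linarith
    _ = 2 * L ^ 2 / n := by field_simp

lemma US_succ (a b : ℕ) (h : ℕ → ℕ) (k : ℕ) :
    US a b h (k + 1) = US a b h k + UM1prev b h (k + 1) := by
  cases k <;> simp [US, UM1prev]

lemma US_congr {a b : ℕ} {h h' : ℕ → ℕ} {r : ℕ} (H : ∀ s, 1 ≤ s → s < r → h s = h' s) :
    US a b h r = US a b h' r := by
  induction r with
  | zero => rfl
  | succ k ih =>
    rw [US, US, ih fun s h1 h2 => H s h1 (by omega)]
    split_ifs with hk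
    · rfl
    · rw [H k (by omega) (by omega)]

lemma UM1prev_congr {b : ℕ} {h h' : ℕ → ℕ} {r : ℕ} (H : ∀ s, 1 ≤ s → s < r → h s = h' s) :
    UM1prev b h r = UM1prev b h' r := by
  unfold UM1prev
  split_ifs with hr
  · rfl
  · rw [H (r - 1) (by omega) (by omega)]

lemma UM1prev_le {b : ℕ} {h : ℕ → ℕ} {r : ℕ} {L : ℝ} (hb : (b : ℝ) ≤ L)
    (H : ∀ s, 1 ≤ s → s < r → (h s : ℝ) ≤ L) : (UM1prev b h r : ℝ) ≤ L := by
  unfold UM1prev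
  split_ifs with hr
  · exact hb
  · exact H _ (by omega) (by omega)

lemma US_le {a b : ℕ} {h : ℕ → ℕ} {r : ℕ} {L : ℝ} (ha : (a : ℝ) ≤ L) (hb : (b : ℝ) ≤ L)
    (H : ∀ s, 1 ≤ s → s < r → (h s : ℝ) ≤ L) : (US a b h r : ℝ) ≤ (r + 1) * L := by
  induction r with
  | zero => simpa [US] using ha
  | succ k ih =>
    have h1 := ih fun s h1 h2 => H s h1 (by omega)
    have h2 := UM1prev_le hb H
    rw [US_succ]
    push_cast
    linarith

section Chain

variable {Ω : Type*} {n : ℕ} {q L : ℝ}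
  {A B : Ω → ℕ} {M : Ω → ℕ → Fin 4 → ℕ}

/-- The event that `M₁` has stayed at most `L` in all rounds before round `r`. -/
def pastLE (L : ℝ) (A B : Ω → ℕ) (M : Ω → ℕ → Fin 4 → ℕ) (r : ℕ) : Set Ω :=
  {ω | (A ω : ℝ) ≤ L ∧ (B ω : ℝ) ≤ L ∧ ∀ s, 1 ≤ s → s < r → (M ω s 1 : ℝ) ≤ L}

/-- The variables `M₁^{(-1)}`, `M₁^{(0)}` and `M^{(s)}` for `1 ≤ s < r`. -/
def chainPast (A B : Ω → ℕ) (M : Ω → ℕ → Fin 4 → ℕ) (r : ℕ) (ω : Ω) :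
    ℕ × ℕ × (Finset.Ico 1 r → Fin 4 → ℕ) :=
  (A ω, B ω, fun s => M ω s)

lemma chainPast_eq_iff {r : ℕ} {ω ω' : Ω} :
    chainPast A B M r ω = chainPast A B M r ω' ↔
      A ω = A ω' ∧ B ω = B ω' ∧ ∀ s, 1 ≤ s → s < r → M ω s = M ω' s := by
  simp [chainPast, Prod.ext_iff, funext_iff]

/-- The success probabilities of round `r`. -/
def roundP (n : ℕ) (A B : Ω → ℕ) (M : Ω → ℕ → Fin 4 → ℕ) (r : ℕ) (ω : Ω) : Fin 4 → ℝ :=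
  pvec (n - US (A ω) (B ω) (fun s => M ω s 1) (r - 1)) (UM1prev (B ω) (fun s => M ω s 1) r)

/-- The number of trials of round `r`. -/
def roundN (n : ℕ) (A B : Ω → ℕ) (M : Ω → ℕ → Fin 4 → ℕ) (r : ℕ) (ω : Ω) : ℕ :=
  n - US (A ω) (B ω) (fun s => M ω s 1) r

lemma roundP_congr {r : ℕ} {ω ω' : Ω}
    (h : chainPast A B M r ω = chainPast A B M r ω') :
    roundP n A B M r ω = roundP n A B M r ω' := by
  obtain ⟨hA, hB, hM⟩ := chainPast_eq_iff.1 h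
  unfold roundP
  rw [hA, hB, US_congr (h' := fun s => M ω' s 1) fun s h1 h2 => by rw [hM s h1 (by omega)],
    UM1prev_congr (h' := fun s => M ω' s 1) fun s h1 h2 => by rw [hM s h1 h2]]

lemma roundN_congr {r : ℕ} {ω ω' : Ω}
    (h : chainPast A B M r ω = chainPast A B M r ω') :
    roundN n A B M r ω = roundN n A B M r ω' := by
  obtain ⟨hA, hB, hM⟩ := chainPast_eq_iff.1 h
  unfold roundN
  rw [hA, hB, US_congr (h' := fun s => M ω' s 1) fun s h1 h2 => by rw [hM s h1 h2]]

/-- The numerical facts about round `r` that hold while `M₁` is small. -/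
lemma round_bounds (hL : 0 ≤ L) (hn : 4 ≤ n) (hgrow : ((RparU n q : ℝ) + 1) * L ≤ n / 2)
    {r : ℕ} (hr : 1 ≤ r) (hrR : r ≤ RparU n q) {ω : Ω} (hω : ω ∈ pastLE L A B M r) :
    (∀ j, 0 ≤ roundP n A B M r ω j) ∧
    (roundN n A B M r ω * roundP n A B M r ω 1 ≤ UM1prev (B ω) (fun s => M ω s 1) r) ∧
    (roundN n A B M r ω * roundP n A B M r ω 0 ≤ 2 * L ^ 2 / n) := by
  obtain ⟨hA, hB, hM⟩ := hω
  set h : ℕ → ℕ := fun s => M ω s 1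
  have hU : (US (A ω) (B ω) h r : ℝ) ≤ n / 2 := by
    refine (US_le hA hB hM).trans (le_trans ?_ hgrow)
    gcongr
  have hb := UM1prev_le hB hM (h := h)
  obtain ⟨k, rfl⟩ : ∃ k, r = k + 1 := ⟨r - 1, by omega⟩
  set b := UM1prev (B ω) h (k + 1)
  have hsucc : US (A ω) (B ω) h (k + 1) = US (A ω) (B ω) h k + b := US_succ _ _ _ _
  have hUn : US (A ω) (B ω) h (k + 1) * 2 ≤ n := by
    have : (US (A ω) (B ω) h (k + 1) : ℝ) * 2 ≤ n := by linarith
    exact_mod_cast this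
  set a := n - US (A ω) (B ω) h k with hadef
  have hba : b ≤ a := by omega
  have ha2 : n ≤ 2 * a := by omega
  have hN : (roundN n A B M (k + 1) ω : ℝ) = a - b := by
    rw [← Nat.cast_sub hba]
    congr 1
    change n - US (A ω) (B ω) h (k + 1) = a - b
    omega
  have hP : roundP n A B M (k + 1) ω = pvec a b := rfl
  have ha2' : (n : ℝ) ≤ 2 * a := by exact_mod_cast ha2
  rw [hN, hP]
  exact ⟨pvec_nonneg (by omega) hba, sub_mul_prob1_le (by omega) hba,
    sub_mul_prob0_le hn (by linarith) hba hb⟩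

variable [MeasurableSpace Ω] {P : Measure Ω}

lemma measurable_chainPast (hA : Measurable A) (hB : Measurable B)
    (hM : ∀ r, Measurable fun ω => M ω r) (r : ℕ) : Measurable (chainPast A B M r) :=
  hA.prodMk (hB.prodMk (measurable_pi_lambda _ fun s => hM s))

lemma measurableSet_pastLE (hA : Measurable A) (hB : Measurable B)
    (hM : ∀ r, Measurable fun ω => M ω r) (r : ℕ) : MeasurableSet (pastLE L A B M r) := by
  have : pastLE L A B M r = chainPast A B M r ⁻¹' {t | (t.1 : ℝ) ≤ L ∧ (t.2.1 : ℝ) ≤ L ∧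
      ∀ s, (t.2.2 s 1 : ℝ) ≤ L} := by
    ext ω
    simp [pastLE, chainPast]
  rw [this]
  exact measurable_chainPast hA hB hM r (MeasurableSet.of_discrete)

lemma lintegral_comp_eq_tsum {T : Type*} [MeasurableSpace T] [Countable T]
    [MeasurableSingletonClass T] (μ : Measure Ω) {Y : Ω → T} (hY : Measurable Y) (f : T → ℝ≥0∞) :
    ∫⁻ ω, f (Y ω) ∂μ = ∑' v, f v * μ (Y ⁻¹' {v}) := by
  rw [← lintegral_map (measurable_of_countable f) hY, lintegral_countable']
  exact tsum_congr fun v => by rw [Measure.map_apply hY (measurableSet_singleton v)]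

lemma setLIntegral_eq_tsum_fiber {T : Type*} [MeasurableSpace T] [Countable T]
    [MeasurableSingletonClass T] (μ : Measure Ω) {X : Ω → T} (hX : Measurable X)
    (f : Ω → ℝ≥0∞) (s : Set T) :
    ∫⁻ ω in X ⁻¹' s, f ω ∂μ = ∑' t : s, ∫⁻ ω in X ⁻¹' {t.1}, f ω ∂μ := by
  have : X ⁻¹' s = ⋃ t : s, X ⁻¹' {t.1} := by
    ext ω
    simp
  rw [this, lintegral_iUnion (fun t => hX (measurableSet_singleton _))]
  intro t t' htt'
  exact Disjoint.preimage X (by simpa [Subtype.ext_iff] using htt')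

/-- The conditional mean of `M_i^{(r)}`, integrated over the atom of the past containing `ω₀`. -/
lemma setLIntegral_chainPast_fiber (hc : IsUnderChain n q P A B M) {r : ℕ} (hr : 1 ≤ r)
    (hrR : r ≤ RparU n q) (i : Fin 4) (ω₀ : Ω) (hp : ∀ j, 0 ≤ roundP n A B M r ω₀ j) :
    ∫⁻ ω in chainPast A B M r ⁻¹' {chainPast A B M r ω₀}, (M ω r i : ℝ≥0∞) ∂P =
      ∫⁻ ω in chainPast A B M r ⁻¹' {chainPast A B M r ω₀},
        ENNReal.ofReal (roundN n A B M r ω * roundP n A B M r ω i) ∂P := by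
  obtain ⟨hA, hB, hM, -, -, hchain⟩ := hc
  set E := chainPast A B M r ⁻¹' {chainPast A B M r ω₀} with hE
  have hEm : MeasurableSet E := measurable_chainPast hA hB hM r (measurableSet_singleton _)
  have hmem : ∀ ω, ω ∈ E ↔ A ω = A ω₀ ∧ B ω = B ω₀ ∧ ∀ s, 1 ≤ s → s < r → M ω s = M ω₀ s :=
    fun ω => by rw [hE, Set.mem_preimage, Set.mem_singleton_iff, chainPast_eq_iff]
  have hstep : ∀ v, P.restrict E ((fun ω => M ω r) ⁻¹' {v}) =
      ENNReal.ofReal (multinomialPMF (roundN n A B M r ω₀) (roundP n A B M r ω₀) v) * P E := by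
    intro v
    have h := hchain r hr hrR (A ω₀) (B ω₀) (M ω₀) v
    rw [Measure.restrict_apply (hM r (measurableSet_singleton v))]
    have h1 : (fun ω => M ω r) ⁻¹' {v} ∩ E = {ω | A ω = A ω₀ ∧ B ω = B ω₀ ∧
        (∀ s, 1 ≤ s → s < r → M ω s = M ω₀ s) ∧ M ω r = v} := by
      ext ω
      simp only [Set.mem_inter_iff, hmem, Set.mem_preimage, Set.mem_singleton_iff,
        Set.mem_ofPred_eq]
      tauto
    have h2 : E = {ω | A ω = A ω₀ ∧ B ω = B ω₀ ∧ ∀ s, 1 ≤ s → s < r → M ω s = M ω₀ s} :=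
      Set.ext hmem
    rw [h1, h, ← h2]
    rfl
  rw [lintegral_comp_eq_tsum (P.restrict E) (hM r) fun v => (v i : ℝ≥0∞)]
  simp_rw [hstep, ← mul_assoc]
  rw [ENNReal.tsum_mul_right, tsum_mul_ofReal_multinomialPMF hp (sum_pvec _ _),
    setLIntegral_congr_fun (g := fun _ => ENNReal.ofReal
      (roundN n A B M r ω₀ * roundP n A B M r ω₀ i)) hEm, setLIntegral_const]
  intro ω hω
  simp only
  rw [roundN_congr hω, roundP_congr hω]

/-- The conditional mean of `M_i^{(r)}`, integrated over the event that `M₁` was small so far. -/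
lemma setLIntegral_pastLE (hc : IsUnderChain n q P A B M) {r : ℕ} (hr : 1 ≤ r)
    (hrR : r ≤ RparU n q) (i : Fin 4)
    (hp : ∀ ω ∈ pastLE L A B M r, ∀ j, 0 ≤ roundP n A B M r ω j) :
    ∫⁻ ω in pastLE L A B M r, (M ω r i : ℝ≥0∞) ∂P =
      ∫⁻ ω in pastLE L A B M r,
        ENNReal.ofReal (roundN n A B M r ω * roundP n A B M r ω i) ∂P := by
  have hX : Measurable (chainPast A B M r) := measurable_chainPast hc.1 hc.2.1 hc.2.2.1 r
  have hset : pastLE L A B M r = chainPast A B M r ⁻¹' (chainPast A B M r '' pastLE L A B M r) := by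
    refine (Set.subset_preimage_image _ _).antisymm ?_
    rintro ω ⟨ω', hω', h⟩
    obtain ⟨hA, hB, hM⟩ := chainPast_eq_iff.1 h
    exact ⟨hA ▸ hω'.1, hB ▸ hω'.2.1, fun s h1 h2 => hM s h1 h2 ▸ hω'.2.2 s h1 h2⟩
  rw [hset, setLIntegral_eq_tsum_fiber P hX, setLIntegral_eq_tsum_fiber P hX]
  refine tsum_congr ?_
  rintro ⟨_, ω₀, hω₀, rfl⟩
  exact setLIntegral_chainPast_fiber hc hr hrR i ω₀ (hp ω₀ hω₀)

/-- Maximal inequality for the stopped supermartingale `M₁`. -/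
lemma maximal_inequality (hc : IsUnderChain n q P A B M) (hL : 0 ≤ L) (hn : 4 ≤ n)
    (hgrow : ((RparU n q : ℝ) + 1) * L ≤ n / 2) {r : ℕ} (hr : r ≤ RparU n q) :
    ENNReal.ofReal L * P (pastLE L A B M 1 \ pastLE L A B M (r + 1)) +
      ∫⁻ ω in pastLE L A B M (r + 1), (UM1prev (B ω) (fun s => M ω s 1) (r + 1) : ℝ≥0∞) ∂P
      ≤ ∫⁻ ω, (B ω : ℝ≥0∞) ∂P := by
  induction r with
  | zero =>
    simp only [zero_add, sdiff_self, Set.bot_eq_empty, measure_empty, mul_zero]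
    exact setLIntegral_le_lintegral _ _
  | succ r ih =>
    refine le_trans ?_ (ih (by omega))
    have hG : ∀ s, MeasurableSet (pastLE L A B M s) :=
      fun s => measurableSet_pastLE hc.1 hc.2.1 hc.2.2.1 s
    set G := pastLE L A B M (r + 1)
    set G' := pastLE L A B M (r + 1 + 1)
    have hsub : G' ⊆ G := fun ω hω => ⟨hω.1, hω.2.1, fun s h1 h2 => hω.2.2 s h1 (by omega)⟩
    have hmean : ∫⁻ ω in G, (M ω (r + 1) 1 : ℝ≥0∞) ∂P ≤
        ∫⁻ ω in G, (UM1prev (B ω) (fun s => M ω s 1) (r + 1) : ℝ≥0∞) ∂P := by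
      rw [setLIntegral_pastLE hc (by omega) hr 1
        fun ω hω => (round_bounds hL hn hgrow (by omega) hr hω).1]
      refine setLIntegral_mono' (hG _) fun ω hω => ?_
      rw [← ENNReal.ofReal_natCast]
      exact ENNReal.ofReal_le_ofReal (round_bounds hL hn hgrow (by omega) hr hω).2.1
    have hexit : ENNReal.ofReal L * P (G \ G') ≤ ∫⁻ ω in G \ G', (M ω (r + 1) 1 : ℝ≥0∞) ∂P := by
      rw [← setLIntegral_const]
      refine setLIntegral_mono' ((hG _).diff (hG _)) fun ω hω => ?_
      rw [← ENNReal.ofReal_natCast]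
      refine ENNReal.ofReal_le_ofReal (le_of_not_ge fun hle => hω.2 ⟨hω.1.1, hω.1.2.1, ?_⟩)
      intro s h1 h2
      rcases Nat.lt_succ_iff_lt_or_eq.1 h2 with h | rfl
      · exact hω.1.2.2 s h1 h
      · exact hle
    have hsplit : ∫⁻ ω in G, (M ω (r + 1) 1 : ℝ≥0∞) ∂P =
        ∫⁻ ω in G', (M ω (r + 1) 1 : ℝ≥0∞) ∂P +
          ∫⁻ ω in G \ G', (M ω (r + 1) 1 : ℝ≥0∞) ∂P := by
      rw [← lintegral_inter_add_sdiff _ _ (hG (r + 1 + 1)), Set.inter_eq_right.2 hsub]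
    have hdiff : P (pastLE L A B M 1 \ G') ≤ P (pastLE L A B M 1 \ G) + P (G \ G') := by
      refine (measure_mono ?_).trans (measure_union_le _ _)
      intro ω hω
      by_cases h : ω ∈ G
      · exact Or.inr ⟨h, hω.2⟩
      · exact Or.inl ⟨hω.1, h⟩
    have hprev : ∀ ω, UM1prev (B ω) (fun s => M ω s 1) (r + 1 + 1) = M ω (r + 1) 1 :=
      fun ω => by simp [UM1prev]
    simp_rw [hprev]
    calc _ ≤ ENNReal.ofReal L * (P (pastLE L A B M 1 \ G) + P (G \ G')) +
          ∫⁻ ω in G', (M ω (r + 1) 1 : ℝ≥0∞) ∂P := by gcongr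
      _ = ENNReal.ofReal L * P (pastLE L A B M 1 \ G) + (∫⁻ ω in G', (M ω (r + 1) 1 : ℝ≥0∞) ∂P +
          ENNReal.ofReal L * P (G \ G')) := by ring
      _ ≤ ENNReal.ofReal L * P (pastLE L A B M 1 \ G) + (∫⁻ ω in G', (M ω (r + 1) 1 : ℝ≥0∞) ∂P +
          ∫⁻ ω in G \ G', (M ω (r + 1) 1 : ℝ≥0∞) ∂P) := by gcongr
      _ ≤ _ := by
        rw [← hsplit]
        gcongr

/-- Markov's inequality for `M₀^{(r)}` while `M₁` is small. -/
lemma measure_pastLE_inter_ne_zero_le [IsProbabilityMeasure P] (hc : IsUnderChain n q P A B M)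
    (hL : 0 ≤ L) (hn : 4 ≤ n) (hgrow : ((RparU n q : ℝ) + 1) * L ≤ n / 2) {r : ℕ} (hr : 1 ≤ r)
    (hrR : r ≤ RparU n q) :
    P (pastLE L A B M r ∩ {ω | M ω r 0 ≠ 0}) ≤ ENNReal.ofReal (2 * L ^ 2 / n) := by
  have hG : MeasurableSet (pastLE L A B M r) := measurableSet_pastLE hc.1 hc.2.1 hc.2.2.1 r
  have hm : MeasurableSet {ω | M ω r 0 ≠ 0} :=
    (hc.2.2.1 r) (MeasurableSet.of_discrete (s := {v : Fin 4 → ℕ | v 0 ≠ 0}))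
  calc P (pastLE L A B M r ∩ {ω | M ω r 0 ≠ 0})
      = ∫⁻ _ in pastLE L A B M r ∩ {ω | M ω r 0 ≠ 0}, 1 ∂P := by simp
    _ ≤ ∫⁻ ω in pastLE L A B M r ∩ {ω | M ω r 0 ≠ 0}, (M ω r 0 : ℝ≥0∞) ∂P := by
        refine setLIntegral_mono' (hG.inter hm) fun ω hω => ?_
        exact_mod_cast Nat.one_le_iff_ne_zero.2 hω.2
    _ ≤ ∫⁻ ω in pastLE L A B M r, (M ω r 0 : ℝ≥0∞) ∂P :=
        lintegral_mono_set Set.inter_subset_left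
    _ = ∫⁻ ω in pastLE L A B M r,
          ENNReal.ofReal (roundN n A B M r ω * roundP n A B M r ω 0) ∂P :=
        setLIntegral_pastLE hc hr hrR 0 fun ω hω => (round_bounds hL hn hgrow hr hrR hω).1
    _ ≤ ∫⁻ _ in pastLE L A B M r, ENNReal.ofReal (2 * L ^ 2 / n) ∂P :=
        setLIntegral_mono' hG fun ω hω =>
          ENNReal.ofReal_le_ofReal (round_bounds hL hn hgrow hr hrR hω).2.2
    _ ≤ ENNReal.ofReal (2 * L ^ 2 / n) := by
        rw [setLIntegral_const]
        exact mul_le_of_le_one_right (by positivity) prob_le_one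

/-- Non-asymptotic bound for the probability that some `M₁` is large or some `M₀` is nonzero. -/
lemma measure_compl_le [IsProbabilityMeasure P] (hc : IsUnderChain n q P A B M)
    (hL : 0 < L) (hn : 4 ≤ n) (hgrow : ((RparU n q : ℝ) + 1) * L ≤ n / 2) {m : ℝ}
    (hm : ∑' v : ℕ, (v : ℝ≥0∞) * P {ω | B ω = v} ≤ ENNReal.ofReal m) :
    P {ω | (∀ r, 1 ≤ r → r ≤ RparU n q → M ω r 0 = 0) ∧ ((A ω : ℝ) ≤ L ∧ (B ω : ℝ) ≤ L ∧
        ∀ r, 1 ≤ r → r ≤ RparU n q → (M ω r 1 : ℝ) ≤ L)}ᶜ ≤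
      P {ω | (A ω : ℝ) ≤ L}ᶜ + P {ω | (B ω : ℝ) ≤ L}ᶜ + ENNReal.ofReal (m / L) +
        ENNReal.ofReal (RparU n q * (2 * L ^ 2 / n)) := by
  set R := RparU n q
  have hmax : P (pastLE L A B M 1 \ pastLE L A B M (R + 1)) ≤ ENNReal.ofReal (m / L) := by
    have h1 := le_self_add.trans (maximal_inequality hc hL.le hn hgrow (le_refl R))
    rw [lintegral_comp_eq_tsum P hc.2.1 fun v => (v : ℝ≥0∞)] at h1
    rw [ENNReal.ofReal_div_of_pos hL, ENNReal.le_div_iff_mul_le (by simp [hL]) (by simp), mul_comm]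
    exact h1.trans hm
  have hM0 : P (⋃ r ∈ Finset.Icc 1 R, pastLE L A B M r ∩ {ω | M ω r 0 ≠ 0}) ≤
      ENNReal.ofReal (R * (2 * L ^ 2 / n)) := by
    refine (measure_biUnion_finset_le _ _).trans ?_
    refine (Finset.sum_le_card_nsmul _ _ (ENNReal.ofReal (2 * L ^ 2 / n)) fun r hr => ?_).trans ?_
    · rw [Finset.mem_Icc] at hr
      exact measure_pastLE_inter_ne_zero_le hc hL.le hn hgrow hr.1 hr.2
    · rw [Nat.card_Icc, Nat.add_sub_cancel, nsmul_eq_mul, ENNReal.ofReal_mul (by positivity),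
        ENNReal.ofReal_natCast]
  refine le_trans (measure_mono (t := (({ω | (A ω : ℝ) ≤ L}ᶜ ∪ {ω | (B ω : ℝ) ≤ L}ᶜ) ∪
    (pastLE L A B M 1 \ pastLE L A B M (R + 1))) ∪
    ⋃ r ∈ Finset.Icc 1 R, pastLE L A B M r ∩ {ω | M ω r 0 ≠ 0}) ?_) ?_
  · intro ω hω
    by_contra hcon
    simp only [Set.mem_union, Set.mem_compl_iff, Set.mem_ofPred_eq, Set.mem_sdiff, Set.mem_iUnion,
      not_or, not_and, not_not, not_exists, Set.mem_inter_iff, Finset.mem_Icc] at hcon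
    obtain ⟨⟨⟨hA, hB⟩, h1⟩, h2⟩ := hcon
    have hG : ω ∈ pastLE L A B M (R + 1) := h1 ⟨hA, hB, fun s _ _ => by omega⟩
    exact hω ⟨fun r hr hrR => h2 r ⟨hr, hrR⟩
      ⟨hA, hB, fun s hs hsr => hG.2.2 s hs (by omega)⟩,
      hA, hB, fun r hr hrR => hG.2.2 r hr (by omega)⟩
  · refine (measure_union_le _ _).trans (add_le_add ?_ hM0)
    exact (measure_union_le _ _).trans (add_le_add (measure_union_le _ _) hmax)

end Chain

lemma eventually_RparU_growth {q : ℝ} (hq0 : 0 < q) (hq : q < 1 / 3) :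
    ∀ᶠ n : ℕ in atTop, 4 ≤ n ∧ 0 < (n : ℝ) ^ q * Real.log n ∧
      ((RparU n q : ℝ) + 1) * ((n : ℝ) ^ q * Real.log n) ≤ n / 2 ∧
      RparU n q * (2 * ((n : ℝ) ^ q * Real.log n) ^ 2 / n) ≤ 2 / Real.log n := by
  have hlogtop : Tendsto (fun n : ℕ => Real.log n) atTop atTop :=
    Real.tendsto_log_atTop.comp tendsto_natCast_atTop_atTop
  have hpow : Tendsto (fun n : ℕ => (n : ℝ) ^ q) atTop atTop :=
    (tendsto_rpow_atTop hq0).comp tendsto_natCast_atTop_atTop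
  have hlog : ∀ᶠ n : ℕ in atTop, Real.log n ≤ 1 / 4 * (n : ℝ) ^ (1 - q) := by
    have h := (isLittleO_log_rpow_atTop (r := 1 - q) (by linarith)).bound
      (show (0 : ℝ) < 1 / 4 by norm_num)
    filter_upwards [tendsto_natCast_atTop_atTop.eventually h] with n hn
    rw [Real.norm_of_nonneg (show (0 : ℝ) ≤ (n : ℝ) ^ (1 - q) by positivity)] at hn
    exact (le_abs_self _).trans hn
  filter_upwards [eventually_ge_atTop 4, hlogtop.eventually_ge_atTop 1,
    hpow.eventually_ge_atTop 4, hlog] with n hn hl hp hlp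
  have hn0 : (0 : ℝ) < n := by positivity
  have hl0 : 0 < Real.log n := by linarith
  have hR : (RparU n q : ℝ) ≤ (n : ℝ) ^ (1 - 2 * q) / Real.log n ^ 3 :=
    Nat.floor_le (by positivity)
  have hx : (0 : ℝ) < (n : ℝ) ^ q := by positivity
  have e1 : (n : ℝ) ^ (1 - 2 * q) = n / ((n : ℝ) ^ q) ^ 2 := by
    rw [Real.rpow_sub hn0, Real.rpow_one, mul_comm 2 q, Real.rpow_mul hn0.le, Real.rpow_two]
  have e2 : (n : ℝ) ^ (1 - q) = n / (n : ℝ) ^ q := by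
    rw [Real.rpow_sub hn0, Real.rpow_one]
  rw [e1] at hR
  rw [e2] at hlp
  set x := (n : ℝ) ^ q
  set l := Real.log n
  refine ⟨hn, by positivity, ?_, ?_⟩
  · have h1 : (RparU n q : ℝ) * (x * l) ≤ n / 4 := by
      calc (RparU n q : ℝ) * (x * l) ≤ n / x ^ 2 / l ^ 3 * (x * l) := by gcongr
        _ = n / (x * l ^ 2) := by field_simp
        _ ≤ n / (4 * 1 ^ 2) := by gcongr
        _ = n / 4 := by norm_num
    have h2 : x * l ≤ n / 4 := by
      calc x * l ≤ x * (1 / 4 * (n / x)) := by gcongr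
        _ = n / 4 := by field_simp
    linarith
  · calc (RparU n q : ℝ) * (2 * (x * l) ^ 2 / n) ≤ n / x ^ 2 / l ^ 3 * (2 * (x * l) ^ 2 / n) := by
          gcongr
      _ = 2 / l := by field_simp

/-- for the under-constrained counting chain with `q ∈ (0, 1/3)`,
`P(M₀^{(r)} = 0 ∀ r ∈ [1,R] | M₁^{(r)} ≤ n^q log n ∀ r ∈ {−1,0,1,…,R}) → 1`.
(The conditioning event lists `M₁^{(−1)} = A`, `M₁^{(0)} = B`, and the rounds `1,…,R`.) -/
theorem statement17 (q : ℝ) (hq0 : 0 < q) (hq : q < 1 / 3)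
    (C₀ : ℝ) (hC₀ : 0 < C₀)
    (Ω : ℕ → Type*) [∀ n, MeasurableSpace (Ω n)]
    (P : ∀ n, Measure (Ω n)) [∀ n, IsProbabilityMeasure (P n)]
    (A B : ∀ n, Ω n → ℕ) (M : ∀ n, Ω n → ℕ → Fin 4 → ℕ)
    (hchain : ∀ n, 2 ≤ n → IsUnderChain n q (P n) (A n) (B n) (M n))
    (hEB : ∀ n, (∑' v : ℕ, (v : ℝ≥0∞) * (P n) {ω | B n ω = v})
      ≤ ENNReal.ofReal (C₀ * (n : ℝ) ^ q))
    (hAt : Tendsto (fun n => ((P n) {ω | (A n ω : ℝ) ≤ (n : ℝ) ^ q * Real.log n}).toReal)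
      atTop (𝓝 1))
    (hBt : Tendsto (fun n => ((P n) {ω | (B n ω : ℝ) ≤ (n : ℝ) ^ q * Real.log n}).toReal)
      atTop (𝓝 1)) :
    Tendsto
      (fun n =>
        ((P n) {ω | (∀ r, 1 ≤ r → r ≤ RparU n q → M n ω r 0 = 0) ∧
            ((A n ω : ℝ) ≤ (n : ℝ) ^ q * Real.log n ∧
             (B n ω : ℝ) ≤ (n : ℝ) ^ q * Real.log n ∧
             ∀ r, 1 ≤ r → r ≤ RparU n q →
               (M n ω r 1 : ℝ) ≤ (n : ℝ) ^ q * Real.log n)}).toReal /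
        ((P n) {ω | (A n ω : ℝ) ≤ (n : ℝ) ^ q * Real.log n ∧
             (B n ω : ℝ) ≤ (n : ℝ) ^ q * Real.log n ∧
             ∀ r, 1 ≤ r → r ≤ RparU n q →
               (M n ω r 1 : ℝ) ≤ (n : ℝ) ^ q * Real.log n}).toReal)
      atTop (𝓝 1) := by
  have hcompl : ∀ (X : ∀ n, Ω n → ℕ), (∀ n, 2 ≤ n → Measurable (X n)) →
      Tendsto (fun n => ((P n) {ω | (X n ω : ℝ) ≤ (n : ℝ) ^ q * Real.log n}).toReal)
        atTop (𝓝 1) →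
      Tendsto (fun n => ((P n) {ω | (X n ω : ℝ) ≤ (n : ℝ) ^ q * Real.log n}ᶜ).toReal)
        atTop (𝓝 0) := by
    intro X hX h
    have h' := h.const_sub 1
    rw [sub_self] at h'
    refine h'.congr' ?_
    filter_upwards [eventually_ge_atTop 2] with n hn
    have hm : MeasurableSet {ω | (X n ω : ℝ) ≤ (n : ℝ) ^ q * Real.log n} :=
      hX n hn (MeasurableSet.of_discrete (s := {k : ℕ | (k : ℝ) ≤ (n : ℝ) ^ q * Real.log n}))
    exact (probReal_compl_eq_one_sub hm).symm
  have hA0 := hcompl A (fun n hn => (hchain n hn).1) hAt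
  have hB0 := hcompl B (fun n hn => (hchain n hn).2.1) hBt
  have hlogtop : Tendsto (fun n : ℕ => Real.log n) atTop atTop :=
    Real.tendsto_log_atTop.comp tendsto_natCast_atTop_atTop
  have hlow := (((hA0.add hB0).add (hlogtop.const_div_atTop C₀)).add
    (hlogtop.const_div_atTop 2)).const_sub 1
  simp only [add_zero, sub_zero] at hlow
  refine tendsto_of_tendsto_of_tendsto_of_le_of_le' hlow tendsto_const_nhds ?_ ?_
  · filter_upwards [eventually_RparU_growth hq0 hq] with n ⟨hn, hL, hgrow, hsmall⟩
    have hbound := measure_compl_le (hchain n (by omega)) hL hn hgrow (hEB n)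
    have hx : (0 : ℝ) < (n : ℝ) ^ q := by positivity
    have hl : 0 < Real.log n := pos_of_mul_pos_right hL hx.le
    rw [mul_comm C₀, mul_div_mul_left _ _ hx.ne'] at hbound
    have hreal := ENNReal.toReal_mono (by finiteness) hbound
    rw [ENNReal.toReal_add (by finiteness) (by finiteness),
      ENNReal.toReal_add (by finiteness) (by finiteness),
      ENNReal.toReal_add (by finiteness) (by finiteness),
      ENNReal.toReal_ofReal (by positivity), ENNReal.toReal_ofReal (by positivity)] at hreal
    set num := {ω | (∀ r, 1 ≤ r → r ≤ RparU n q → M n ω r 0 = 0) ∧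
      ((A n ω : ℝ) ≤ (n : ℝ) ^ q * Real.log n ∧ (B n ω : ℝ) ≤ (n : ℝ) ^ q * Real.log n ∧
        ∀ r, 1 ≤ r → r ≤ RparU n q → (M n ω r 1 : ℝ) ≤ (n : ℝ) ^ q * Real.log n)}
    have hone : (1 : ℝ) ≤ ((P n) num).toReal + ((P n) numᶜ).toReal := by
      have h := measureReal_union_le (μ := P n) num numᶜ
      rwa [Set.union_compl_self, probReal_univ] at h
    refine le_trans (b := ((P n) num).toReal) (by linarith) ?_
    set den := {ω | (A n ω : ℝ) ≤ (n : ℝ) ^ q * Real.log n ∧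
      (B n ω : ℝ) ≤ (n : ℝ) ^ q * Real.log n ∧
        ∀ r, 1 ≤ r → r ≤ RparU n q → (M n ω r 1 : ℝ) ≤ (n : ℝ) ^ q * Real.log n}
    have hle : ((P n) num).toReal ≤ ((P n) den).toReal :=
      measureReal_mono (μ := P n) fun ω hω => hω.2
    have hden1 : ((P n) den).toReal ≤ 1 := measureReal_le_one
    rcases (ENNReal.toReal_nonneg (a := (P n) den)).eq_or_lt with h0 | h0
    · rw [← h0] at hle ⊢
      simpa using hle
    · exact le_div_self ENNReal.toReal_nonneg h0 hden1
  · refine Eventually.of_forall fun n => div_le_one_of_le₀ ?_ ENNReal.toReal_nonneg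
    exact measureReal_mono (μ := P n) fun ω hω => hω.2
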